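/- Let 0 < ε < 1, ρ > 0, and let (x_k)_{k∈ℤ} be a (ρ, ε)-lattice. Then for every continuously differentiable f : ℝ → ℂ and every k ∈ ℤ: |f(x_k)| ≤ (1+ε)² ρ^{−1/2} ‖f‖_{L²(I_k)} + ρ^{1/2} ‖f′‖_{L²(I_k)}. -/

import Mathlib

open MeasureTheory Filter Set

/-- A `(ρ, ε)`-lattice on `ℝ`: a strictly increasing two-sided sequence tending to `±∞`
with `ρ/(1+ε) ≤ x_{k+1} − x_k ≤ ρ` for all `k`. -/
def IsLattice (ρ ε : ℝ) (x : ℤ → ℝ) : Prop :=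
  StrictMono x ∧ Tendsto x atTop atTop ∧ Tendsto x atBot atBot ∧
  ∀ k : ℤ, ρ / (1 + ε) ≤ x (k + 1) - x k ∧ x (k + 1) - x k ≤ ρ

/-- The Cauchy–Schwarz inequality against the constant function `1` on an interval. -/
theorem sq_intervalIntegral_le {g : ℝ → ℝ} (hg : Continuous g) {a b : ℝ} (hab : a < b) :
    (∫ t in a..b, g t) ^ 2 ≤ (b - a) * ∫ t in a..b, g t ^ 2 := by
  set S := ∫ t in a..b, g t with hS
  have hnonneg : 0 ≤ ∫ t in a..b, ((b - a) * g t - S) ^ 2 :=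
    intervalIntegral.integral_nonneg hab.le fun t _ => sq_nonneg _
  have hexpand : ∫ t in a..b, ((b - a) * g t - S) ^ 2 =
      (b - a) * ((b - a) * (∫ t in a..b, g t ^ 2) - S ^ 2) := by
    have h : ∀ t, ((b - a) * g t - S) ^ 2 =
        (b - a) ^ 2 * g t ^ 2 - 2 * (b - a) * S * g t + S ^ 2 := fun t => by ring
    simp_rw [h]
    rw [intervalIntegral.integral_add, intervalIntegral.integral_sub,
      intervalIntegral.integral_const_mul, intervalIntegral.integral_const_mul,
      intervalIntegral.integral_const, ← hS, smul_eq_mul]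
    · ring
    all_goals exact Continuous.intervalIntegrable (by fun_prop) _ _
  rw [hexpand] at hnonneg
  linarith [nonneg_of_mul_nonneg_right hnonneg (sub_pos.2 hab)]

/-- A continuous function attains on a compact interval a value bounded by its quadratic mean. -/
theorem exists_mul_norm_sq_le_integral {E : Type*} [NormedAddCommGroup E] {f : ℝ → E}
    (hf : Continuous f) {a b : ℝ} (hab : a < b) :
    ∃ c ∈ Icc a b, (b - a) * ‖f c‖ ^ 2 ≤ ∫ t in a..b, ‖f t‖ ^ 2 := by
  obtain ⟨c, hc, hmin⟩ := isCompact_Icc.exists_isMinOn (nonempty_Icc.2 hab.le)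
    (hf.norm.continuousOn (s := Icc a b))
  refine ⟨c, hc, ?_⟩
  have h : ∫ _ in a..b, ‖f c‖ ^ 2 ≤ ∫ t in a..b, ‖f t‖ ^ 2 := by
    refine intervalIntegral.integral_mono_on hab.le
      (Continuous.intervalIntegrable (by fun_prop) _ _)
      (Continuous.intervalIntegrable (by fun_prop) _ _) fun t ht => ?_
    have : ‖f c‖ ≤ ‖f t‖ := hmin ht
    gcongr
  simpa using h

/-- The increment of a `C¹` function from the left endpoint is controlled by the `L²` norm of its
derivative. -/
theorem norm_sub_le_sqrt_mul_sqrt_integral {E : Type*} [NormedAddCommGroup E] [NormedSpace ℝ E]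
    [CompleteSpace E] {f : ℝ → E} (hf : ContDiff ℝ 1 f) {a b c : ℝ} (hab : a < b)
    (hc : c ∈ Icc a b) :
    ‖f c - f a‖ ≤ √(b - a) * √(∫ t in a..b, ‖deriv f t‖ ^ 2) := by
  have hd : Continuous (deriv f) := hf.continuous_deriv le_rfl
  rw [← intervalIntegral.integral_deriv_eq_sub
    (fun t _ => (hf.differentiable one_ne_zero).differentiableAt) (hd.intervalIntegrable _ _),
    ← Real.sqrt_mul (sub_pos.2 hab).le]
  calc ‖∫ t in a..c, deriv f t‖ ≤ ∫ t in a..c, ‖deriv f t‖ :=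
        intervalIntegral.norm_integral_le_integral_norm hc.1
    _ ≤ ∫ t in a..b, ‖deriv f t‖ :=
        intervalIntegral.integral_mono_interval le_rfl hc.1 hc.2
          (Eventually.of_forall fun _ => norm_nonneg _) (hd.norm.intervalIntegrable _ _)
    _ ≤ _ := Real.le_sqrt_of_sq_le (sq_intervalIntegral_le hd.norm hab)

/-- Pointwise sampling estimate on a lattice interval:
`|f(x_k)| ≤ (1+ε)² ρ^{−1/2} ‖f‖_{L²(I_k)} + ρ^{1/2} ‖f′‖_{L²(I_k)}`. -/
theorem pointwise_sampling_estimate (ρ ε : ℝ) (hε0 : 0 < ε) (hε1 : ε < 1) (hρ : 0 < ρ)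
    (x : ℤ → ℝ) (hx : IsLattice ρ ε x)
    (f : ℝ → ℂ) (hf : ContDiff ℝ 1 f) (k : ℤ) :
    ‖f (x k)‖ ≤
      (1 + ε) ^ 2 / Real.sqrt ρ *
          Real.sqrt (∫ t in Ioo (x k) (x (k + 1)), ‖f t‖ ^ 2) +
        Real.sqrt ρ * Real.sqrt (∫ t in Ioo (x k) (x (k + 1)), ‖deriv f t‖ ^ 2) := by
  obtain ⟨hmono, -, -, hgap⟩ := hx
  obtain ⟨hlow, hupp⟩ := hgap k
  have hab : x k < x (k + 1) := hmono (lt_add_one k)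
  simp_rw [← integral_Ioc_eq_integral_Ioo, ← intervalIntegral.integral_of_le hab.le]
  obtain ⟨c, hc, hcle⟩ := exists_mul_norm_sq_le_integral hf.continuous hab
  have hvalue : ‖f c‖ ≤ (1 + ε) ^ 2 / √ρ * √(∫ t in x k..x (k + 1), ‖f t‖ ^ 2) := by
    set A := ∫ t in x k..x (k + 1), ‖f t‖ ^ 2
    have hmul : ρ * ‖f c‖ ^ 2 ≤ (1 + ε) * A := by
      have h : ρ / (1 + ε) * ‖f c‖ ^ 2 ≤ A := le_trans (by gcongr) hcle
      rw [div_mul_eq_mul_div, div_le_iff₀ (by positivity)] at h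
      linarith
    have hA : 0 ≤ A := by
      have : 0 ≤ (1 + ε) * A := le_trans (by positivity) hmul
      exact nonneg_of_mul_nonneg_right this (by positivity)
    refine (sq_le_sq₀ (norm_nonneg _) (by positivity)).1 ?_
    rw [mul_pow, div_pow, Real.sq_sqrt hρ.le, Real.sq_sqrt hA, div_mul_eq_mul_div,
      le_div_iff₀ hρ, ← pow_mul]
    have hpow : 1 + ε ≤ (1 + ε) ^ (2 * 2) := le_self_pow₀ (by linarith) (by norm_num)
    linarith [mul_le_mul_of_nonneg_right hpow hA]
  have hincr : ‖f c - f (x k)‖ ≤ √ρ * √(∫ t in x k..x (k + 1), ‖deriv f t‖ ^ 2) :=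
    (norm_sub_le_sqrt_mul_sqrt_integral hf hab hc).trans (by gcongr)
  calc ‖f (x k)‖ ≤ ‖f c‖ + ‖f c - f (x k)‖ := norm_le_norm_add_norm_sub _ _
    _ ≤ _ := add_le_add hvalue hincr
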